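/- If φ ∈ UID(U), then φ is locally (1/2)-little Hölder in the Euclidean sense: for every open U' ⋐ U, lim_{r→0} sup{ |φ(b) − φ(a)|/|b − a|^{1/2} : a, b ∈ U', 0 < |b − a| < r } = 0, where |b − a| denotes the Euclidean distance in ℝ^{m−1+h}. -/

import Mathlib

open MeasureTheory Filter Topology

namespace Step2

/-- The underlying space of the step-2 Carnot group `G = ℝ^m × ℝ^h`. -/
abbrev G (m h : ℕ) := (Fin m → ℝ) × (Fin h → ℝ)

variable {m h : ℕ}

/-- Group product `(x,y)·(x',y') = (x+x', y+y' - (1/2)⟨Bx,x'⟩)`. -/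
noncomputable def gmul (B : Fin h → Matrix (Fin m) (Fin m) ℝ) (p q : G m h) : G m h :=
  (p.1 + q.1, fun i => p.2 i + q.2 i - (1 / 2) * ∑ j, ∑ k, B i j k * p.1 k * q.1 j)

/-- Group inverse `g⁻¹ = -g`. -/
def ginv (p : G m h) : G m h := (-p.1, -p.2)

/-- Homogeneous norm `‖(x,y)‖ = Σ|x_j| + Σ|y_i|^(1/2)`. -/
noncomputable def hnorm (p : G m h) : ℝ :=
  (∑ j, |p.1 j|) + ∑ i, Real.sqrt |p.2 i|

/-- Homogeneous (quasi-)distance `d(p,q) = ‖p⁻¹·q‖`. -/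
noncomputable def gdist (B : Fin h → Matrix (Fin m) (Fin m) ℝ) (p q : G m h) : ℝ :=
  hnorm (gmul B (ginv p) q)

/-- Euclidean distance on `G`. -/
noncomputable def eDist (p q : G m h) : ℝ :=
  Real.sqrt ((∑ j, (p.1 j - q.1 j) ^ 2) + ∑ i, (p.2 i - q.2 i) ^ 2)

/-- The subgroup `W = {x_1 = 0}`. -/
def Wset (m h : ℕ) [NeZero m] : Set (G m h) := {p | p.1 0 = 0}

/-- `U` is (relatively) open in `W`. -/
def RelOpen (m h : ℕ) [NeZero m] (U : Set (G m h)) : Prop :=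
  ∃ O : Set (G m h), IsOpen O ∧ U = O ∩ Wset m h

/-- The graphing map `Φ(w) = (φ(w),0,…,0) ∈ L`. -/
noncomputable def Phi [NeZero m] (φ : G m h → ℝ) (w : G m h) : G m h :=
  ((fun j => if j = 0 then φ w else 0), 0)

/-- Horizontal coordinate vector `e_{x_j}`. -/
def eH (m h : ℕ) (j : Fin m) : G m h := ((fun j' => if j' = j then 1 else 0), 0)

/-- Vertical coordinate vector `e_{y_i}`. -/
def eV (m h : ℕ) (i : Fin h) : G m h := (0, fun i' => if i' = i then 1 else 0)

/-- The projected vector field `D^φ_j` (for `j ≠ 0`, i.e. `j = 2,…,m` in 1-based indexing):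
`D^φ_j|_w = ∂_{x_j} - Σ_i ( b^(i)_{j1} φ(w) + (1/2) Σ_{k≥2} x_k b^(i)_{jk} ) ∂_{y_i}`. -/
noncomputable def Dvec [NeZero m] (B : Fin h → Matrix (Fin m) (Fin m) ℝ)
    (φ : G m h → ℝ) (j : Fin m) (w : G m h) : G m h :=
  ((fun j' => if j' = j then 1 else 0),
   fun i => -(B i j 0 * φ w
      + (1 / 2) * ∑ k ∈ Finset.univ.erase (0 : Fin m), w.1 k * B i j k))

/-- `D^φφ = ω` in the broad* sense on `U`. -/
def IsBroadStar [NeZero m] (B : Fin h → Matrix (Fin m) (Fin m) ℝ) (U : Set (G m h))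
    (φ : G m h → ℝ) (ω : G m h → Fin m → ℝ) : Prop :=
  ∀ a₀ ∈ U, ∃ δ₁ δ₂ : ℝ, 0 < δ₂ ∧ δ₂ < δ₁ ∧
    ∀ j : Fin m, j ≠ 0 → ∃ E : G m h → ℝ → G m h,
      ∀ a, a ∈ U → eDist a a₀ ≤ δ₂ →
        (∀ t ∈ Set.Icc (-δ₂) δ₂, E a t ∈ U ∧ eDist (E a t) a₀ ≤ δ₁) ∧
        E a 0 = a ∧
        (∀ t ∈ Set.Icc (-δ₂) δ₂,
          HasDerivWithinAt (E a) (Dvec B φ j (E a t)) (Set.Icc (-δ₂) δ₂) t) ∧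
        (∀ t ∈ Set.Icc (-δ₂) δ₂, φ (E a t) - φ a = ∫ s in (0:ℝ)..t, ω (E a s) j)

/-- `φ` is vertically broad* Hölder on `U`. -/
def VertHolder (m h : ℕ) [NeZero m] (U : Set (G m h)) (φ : G m h → ℝ) : Prop :=
  ∀ a₀ ∈ U, ∃ U' : Set (G m h), RelOpen m h U' ∧ a₀ ∈ U' ∧
    IsCompact (closure U') ∧ closure U' ⊆ U ∧
    ∀ i : Fin h, ∀ ε > (0:ℝ), ∃ ρ > (0:ℝ), ∀ p ∈ U', ∀ q ∈ U',
      p.1 = q.1 → (∀ i' : Fin h, i' ≠ i → p.2 i' = q.2 i') →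
      0 < |p.2 i - q.2 i| → |p.2 i - q.2 i| ≤ ρ →
      |φ p - φ q| ≤ ε * Real.sqrt |p.2 i - q.2 i|

/-- The translated point `Φ(a)⁻¹·a⁻¹·b·Φ(a)`. -/
noncomputable def shiftQ [NeZero m] (B : Fin h → Matrix (Fin m) (Fin m) ℝ)
    (φ : G m h → ℝ) (a b : G m h) : G m h :=
  gmul B (gmul B (gmul B (ginv (Phi φ a)) (ginv a)) b) (Phi φ a)

/-- `φ` is intrinsically differentiable at `a₀` with intrinsic gradient `grad`. -/
def IDAt [NeZero m] (B : Fin h → Matrix (Fin m) (Fin m) ℝ) (U : Set (G m h))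
    (φ : G m h → ℝ) (a₀ : G m h) (grad : Fin m → ℝ) : Prop :=
  ∀ ε > (0:ℝ), ∃ r > (0:ℝ), ∀ b ∈ U, 0 < gdist B a₀ b → gdist B a₀ b < r →
    |φ b - φ a₀ - ∑ j ∈ Finset.univ.erase (0 : Fin m), grad j * (b.1 j - a₀.1 j)|
      ≤ ε * hnorm (shiftQ B φ a₀ b)

/-- `φ` is uniformly intrinsically differentiable at `a₀` with intrinsic gradient `grad`. -/
def UIDAt [NeZero m] (B : Fin h → Matrix (Fin m) (Fin m) ℝ) (U : Set (G m h))
    (φ : G m h → ℝ) (a₀ : G m h) (grad : Fin m → ℝ) : Prop :=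
  ∀ ε > (0:ℝ), ∃ r > (0:ℝ), ∀ a ∈ U, ∀ b ∈ U,
    gdist B a₀ a < r → gdist B a₀ b < r → a ≠ b →
    |φ b - φ a - ∑ j ∈ Finset.univ.erase (0 : Fin m), grad j * (b.1 j - a.1 j)|
      ≤ ε * hnorm (shiftQ B φ a b)

/-- Projection onto `L` in the splitting `G = W·L`. -/
def piL (m h : ℕ) [NeZero m] (g : G m h) : G m h :=
  ((fun j => if j = 0 then g.1 0 else 0), 0)

/-- Projection onto `W` in the splitting `G = W·L`. -/
noncomputable def piW [NeZero m] (B : Fin h → Matrix (Fin m) (Fin m) ℝ) (g : G m h) : G m h :=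
  ((fun j => if j = 0 then 0 else g.1 j),
   fun i => g.2 i + (1 / 2) * g.1 0 * ∑ k ∈ Finset.univ.erase (0 : Fin m), B i 0 k * g.1 k)

/-- Coordinates `ℝ^(m-1) × ℝ^h → W ⊆ G`. -/
def emb (m h : ℕ) (u : (Fin (m - 1) → ℝ) × (Fin h → ℝ)) : G m h :=
  ((fun j => if hj : (j : ℕ) = 0 then 0
      else u.1 ⟨(j : ℕ) - 1, by have := j.isLt; omega⟩), u.2)

/-- The Lebesgue measure on `W`, as a measure on `G`. -/
noncomputable def muW (m h : ℕ) : Measure (G m h) :=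
  Measure.map (emb m h) volume

end Step2

namespace Step2

variable {m h : ℕ}

theorem abs_sub_fst_le_eDist (p q : G m h) (j : Fin m) : |p.1 j - q.1 j| ≤ eDist p q := by
  refine Real.abs_le_sqrt ?_
  have h1 := Finset.single_le_sum (f := fun j => (p.1 j - q.1 j) ^ 2)
    (fun j _ => sq_nonneg _) (Finset.mem_univ j)
  have h2 : 0 ≤ ∑ i, (p.2 i - q.2 i) ^ 2 := Finset.sum_nonneg fun i _ => sq_nonneg _
  linarith

theorem abs_sub_snd_le_eDist (p q : G m h) (i : Fin h) : |p.2 i - q.2 i| ≤ eDist p q := by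
  refine Real.abs_le_sqrt ?_
  have h1 := Finset.single_le_sum (f := fun i => (p.2 i - q.2 i) ^ 2)
    (fun i _ => sq_nonneg _) (Finset.mem_univ i)
  have h2 : 0 ≤ ∑ j, (p.1 j - q.1 j) ^ 2 := Finset.sum_nonneg fun j _ => sq_nonneg _
  linarith

theorem eDist_comm (p q : G m h) : eDist p q = eDist q p := by
  simp only [eDist, sub_sq_comm]

theorem eDist_nonneg (p q : G m h) : 0 ≤ eDist p q := Real.sqrt_nonneg _

theorem eDist_self (p : G m h) : eDist p p = 0 := by simp [eDist]

theorem norm_fst_sub_le_eDist (p q : G m h) : ‖p.1 - q.1‖ ≤ eDist p q :=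
  (pi_norm_le_iff_of_nonneg (eDist_nonneg p q)).2 fun j => abs_sub_fst_le_eDist p q j

theorem dist_le_eDist (p q : G m h) : dist p q ≤ eDist p q := by
  refine max_le ?_ ?_
  · exact (dist_pi_le_iff (eDist_nonneg p q)).2 fun j => abs_sub_fst_le_eDist p q j
  · exact (dist_pi_le_iff (eDist_nonneg p q)).2 fun i => abs_sub_snd_le_eDist p q i

theorem continuous_eDist : Continuous fun q : G m h × G m h => eDist q.1 q.2 := by
  unfold eDist
  fun_prop

theorem continuous_gdist (B : Fin h → Matrix (Fin m) (Fin m) ℝ) (p : G m h) :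
    Continuous (gdist B p) := by
  unfold gdist hnorm gmul
  fun_prop

theorem sum_matrix_mul_eq_dotProduct (A : Matrix (Fin m) (Fin m) ℝ) (x y : Fin m → ℝ) :
    ∑ j, ∑ k, A j k * x k * y j = y ⬝ᵥ A.mulVec x := by
  simp only [dotProduct, Matrix.mulVec, Finset.mul_sum]
  exact Finset.sum_congr rfl fun j _ => Finset.sum_congr rfl fun k _ => by ring

theorem dotProduct_mulVec_self_of_skew {A : Matrix (Fin m) (Fin m) ℝ} (hA : A.transpose = -A)
    (x : Fin m → ℝ) : x ⬝ᵥ A.mulVec x = 0 := by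
  have h1 : x ⬝ᵥ A.mulVec x = -(x ⬝ᵥ A.mulVec x) := by
    calc x ⬝ᵥ A.mulVec x = A.transpose.mulVec x ⬝ᵥ x := by
          rw [Matrix.dotProduct_mulVec, Matrix.mulVec_transpose]
      _ = -(x ⬝ᵥ A.mulVec x) := by
          rw [hA, Matrix.neg_mulVec, neg_dotProduct, dotProduct_comm]
  linarith

theorem abs_dotProduct_mulVec_le (A : Matrix (Fin m) (Fin m) ℝ) (x y : Fin m → ℝ) :
    |y ⬝ᵥ A.mulVec x| ≤ (∑ j, ∑ k, |A j k|) * ‖x‖ * ‖y‖ := by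
  rw [← sum_matrix_mul_eq_dotProduct, Finset.sum_mul, Finset.sum_mul]
  refine (Finset.abs_sum_le_sum_abs _ _).trans (Finset.sum_le_sum fun j _ => ?_)
  rw [Finset.sum_mul, Finset.sum_mul]
  refine (Finset.abs_sum_le_sum_abs _ _).trans (Finset.sum_le_sum fun k _ => ?_)
  rw [abs_mul, abs_mul]
  gcongr
  · exact norm_le_pi_norm x k
  · exact norm_le_pi_norm y j

theorem shiftQ_fst [NeZero m] (B : Fin h → Matrix (Fin m) (Fin m) ℝ) (φ : G m h → ℝ)
    (a b : G m h) : (shiftQ B φ a b).1 = b.1 - a.1 := by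
  simp only [shiftQ, gmul, ginv]
  abel

theorem shiftQ_snd [NeZero m] {B : Fin h → Matrix (Fin m) (Fin m) ℝ}
    (hskew : ∀ i, (B i).transpose = - B i) (φ : G m h → ℝ) (a b : G m h) (i : Fin h) :
    (shiftQ B φ a b).2 i = b.2 i - a.2 i
      + 1 / 2 * ((b.1 - a.1) ⬝ᵥ (B i).mulVec (Phi φ a).1 + (b.1 - a.1) ⬝ᵥ (B i).mulVec a.1
        - (Phi φ a).1 ⬝ᵥ (B i).mulVec (b.1 - a.1)) := by
  have hf := dotProduct_mulVec_self_of_skew (hskew i) (Phi φ a).1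
  have ha := dotProduct_mulVec_self_of_skew (hskew i) a.1
  have h2 : (Phi φ a).2 = 0 := rfl
  simp only [shiftQ, gmul, ginv, sum_matrix_mul_eq_dotProduct, h2, Matrix.mulVec_add,
    Matrix.mulVec_sub, Matrix.mulVec_neg, dotProduct_add, dotProduct_sub, dotProduct_neg,
    neg_dotProduct, sub_dotProduct]
  simp only [Pi.neg_apply, Pi.zero_apply]
  linarith

theorem norm_Phi_fst_le [NeZero m] (φ : G m h → ℝ) (a : G m h) : ‖(Phi φ a).1‖ ≤ |φ a| := by
  refine (pi_norm_le_iff_of_nonneg (abs_nonneg _)).2 fun j => ?_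
  by_cases hj : j = 0 <;> simp [Phi, hj]

theorem hnorm_shiftQ_le [NeZero m] {B : Fin h → Matrix (Fin m) (Fin m) ℝ}
    (hskew : ∀ i, (B i).transpose = - B i) {φ : G m h → ℝ} {a b : G m h} {R : ℝ}
    (hφ : |φ a| ≤ R) (ha : ‖a.1‖ ≤ R) (he : eDist a b ≤ 1) :
    hnorm (shiftQ B φ a b) ≤
      (m + ∑ i, √(1 + 2 * (∑ j, ∑ k, |B i j k|) * R)) * √(eDist a b) := by
  have hR : 0 ≤ R := (abs_nonneg _).trans hφ
  have he0 := eDist_nonneg a b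
  have hv : ‖b.1 - a.1‖ ≤ eDist a b := eDist_comm b a ▸ norm_fst_sub_le_eDist b a
  have hf := (norm_Phi_fst_le φ a).trans hφ
  unfold hnorm
  rw [add_mul, Finset.sum_mul, shiftQ_fst]
  refine add_le_add ?_ (Finset.sum_le_sum fun i _ => ?_)
  · have h1 : ∀ j ∈ Finset.univ, |(b.1 - a.1) j| ≤ √(eDist a b) := fun j _ =>
      (norm_le_pi_norm (b.1 - a.1) j).trans <| hv.trans <|
        Real.le_sqrt_of_sq_le (by nlinarith)
    simpa using Finset.sum_le_sum h1
  · have hS : 0 ≤ ∑ j, ∑ k, |B i j k| :=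
      Finset.sum_nonneg fun j _ => Finset.sum_nonneg fun k _ => abs_nonneg _
    rw [← Real.sqrt_mul (by positivity), shiftQ_snd hskew]
    refine Real.sqrt_le_sqrt ?_
    have key : ∀ x y : Fin m → ℝ, ‖x‖ * ‖y‖ ≤ R * eDist a b →
        |y ⬝ᵥ (B i).mulVec x| ≤ (∑ j, ∑ k, |B i j k|) * (R * eDist a b) := fun x y hxy =>
      (abs_dotProduct_mulVec_le (B i) x y).trans <| by
        rw [mul_assoc]; exact mul_le_mul_of_nonneg_left hxy hS
    have k1 := abs_le.1 (key (Phi φ a).1 (b.1 - a.1) (by gcongr))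
    have k2 := abs_le.1 (key a.1 (b.1 - a.1) (by gcongr))
    have k3 := abs_le.1 (key (b.1 - a.1) (Phi φ a).1 (by rw [mul_comm]; gcongr))
    have k4 := abs_le.1 (abs_sub_snd_le_eDist a b i)
    have k5 : 0 ≤ (∑ j, ∑ k, |B i j k|) * (R * eDist a b) := by positivity
    rw [abs_le]
    constructor <;> linarith

theorem UIDAt.eventually_abs_sub_le [NeZero m] {B : Fin h → Matrix (Fin m) (Fin m) ℝ}
    (hskew : ∀ i, (B i).transpose = - B i) {U : Set (G m h)} {φ : G m h → ℝ} {a₀ : G m h}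
    {grad : Fin m → ℝ} (hUID : UIDAt B U φ a₀ grad) (hφ : ContinuousWithinAt φ U a₀)
    {ε : ℝ} (hε : 0 < ε) :
    ∀ᶠ q in 𝓝 (a₀, a₀), q.1 ∈ U → q.2 ∈ U → |φ q.2 - φ q.1| ≤ ε * √(eDist q.1 q.2) := by
  set R : ℝ := |φ a₀| + ‖a₀.1‖ + 1 with hRdef
  set M : ℝ := m + ∑ i, √(1 + 2 * (∑ j, ∑ k, |B i j k|) * R) + 1 with hM
  have hMpos : 0 < M := by positivity
  set S : ℝ := ∑ j ∈ Finset.univ.erase (0 : Fin m), |grad j|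
  obtain ⟨r, hr, H⟩ := hUID (ε / (2 * M)) (by positivity)
  have hgd : ∀ᶠ p in 𝓝 a₀, gdist B a₀ p < r := by
    refine (continuous_gdist B a₀).continuousAt.eventually_lt continuousAt_const ?_
    have h0 : gdist B a₀ a₀ = 0 := by
      simp [gdist, gmul, ginv, hnorm, sum_matrix_mul_eq_dotProduct,
        dotProduct_mulVec_self_of_skew (hskew _)]
    rwa [h0]
  have hφR : ∀ᶠ p in 𝓝 a₀, p ∈ U → |φ p| ≤ R := by
    have h1 : ∀ᶠ p in 𝓝[U] a₀, |φ p| < R :=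
      hφ.abs.eventually_lt continuousWithinAt_const (by
        have := norm_nonneg a₀.1
        linarith)
    filter_upwards [eventually_nhdsWithin_iff.1 h1] with p hp hpU using (hp hpU).le
  have hnR : ∀ᶠ p in 𝓝 a₀, ‖p.1‖ < R := by
    have h1 : Continuous fun p : G m h => ‖p.1‖ := by fun_prop
    refine h1.continuousAt.eventually_lt continuousAt_const ?_
    have := abs_nonneg (φ a₀)
    linarith
  have he1 : ∀ᶠ q in 𝓝 (a₀, a₀), eDist q.1 q.2 < 1 :=
    continuous_eDist.continuousAt.eventually_lt continuousAt_const (by simp [eDist_self])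
  have heS : ∀ᶠ q in 𝓝 (a₀, a₀), S * √(eDist q.1 q.2) < ε / 2 := by
    have h1 : Continuous fun q : G m h × G m h => S * √(eDist q.1 q.2) :=
      continuous_const.mul continuous_eDist.sqrt
    exact h1.continuousAt.eventually_lt continuousAt_const (by simpa [eDist_self] using hε)
  filter_upwards [(hgd.and (hφR.and hnR)).prod_inl_nhds a₀, hgd.prod_inr_nhds a₀, he1, heS]
    with ⟨a, b⟩ ⟨hga, hφa, hna⟩ hgb he hS haU hbU
  dsimp only at *
  rcases eq_or_ne a b with rfl | hab
  · simp [eDist_self]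
  have h1 := H a haU b hbU hga hgb hab
  have h2 := hnorm_shiftQ_le hskew (hφa haU) hna.le he.le
  have hs := Real.sqrt_nonneg (eDist a b)
  have hss := Real.mul_self_sqrt (eDist_nonneg a b)
  set s := √(eDist a b)
  have h3 : ε / (2 * M) * hnorm (shiftQ B φ a b) ≤ ε / 2 * s := by
    calc ε / (2 * M) * hnorm (shiftQ B φ a b) ≤ ε / (2 * M) * (M * s) := by
          gcongr
          refine h2.trans ?_
          gcongr
          linarith
      _ = ε / 2 * s := by field_simp
  have h4 : |∑ j ∈ Finset.univ.erase (0 : Fin m), grad j * (b.1 j - a.1 j)| ≤ ε / 2 * s := by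
    calc _ ≤ ∑ j ∈ Finset.univ.erase (0 : Fin m), |grad j| * eDist a b := by
          refine (Finset.abs_sum_le_sum_abs _ _).trans (Finset.sum_le_sum fun j _ => ?_)
          rw [abs_mul, abs_sub_comm (b.1 j)]
          gcongr
          exact abs_sub_fst_le_eDist a b j
      _ = S * s * s := by rw [← Finset.sum_mul, mul_assoc, hss]
      _ ≤ ε / 2 * s := by gcongr
  have h5 := abs_le.1 h4
  have h6 := abs_le.1 (h1.trans h3)
  rw [abs_le]
  constructor <;> linarith

/-- If `φ ∈ UID(U)`, then `φ` is locally `(1/2)`-little Hölder in the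
Euclidean sense: on every relatively open `U' ⋐ U`,
`lim_{r→0} sup { |φ(b)-φ(a)|/|b-a|^(1/2) : a,b ∈ U', 0 < |b-a| < r } = 0`. -/
theorem statement4 (m h : ℕ) [NeZero m] (hm : 2 ≤ m) (hh : 1 ≤ h)
    (B : Fin h → Matrix (Fin m) (Fin m) ℝ)
    (hskew : ∀ i, (B i).transpose = - B i) (hBli : LinearIndependent ℝ B)
    (U : Set (G m h)) (hUW : U ⊆ Wset m h) (hUopen : RelOpen m h U)
    (φ : G m h → ℝ) (hφ : ContinuousOn φ U)
    (hUID : ∀ a₀ ∈ U, ∃ grad : Fin m → ℝ, UIDAt B U φ a₀ grad) :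
    ∀ U' : Set (G m h), RelOpen m h U' → IsCompact (closure U') → closure U' ⊆ U →
      ∀ ε > (0:ℝ), ∃ r > (0:ℝ), ∀ a ∈ U', ∀ b ∈ U',
        0 < eDist a b → eDist a b < r →
        |φ b - φ a| ≤ ε * Real.sqrt (eDist a b) := by
  intro U' _ hcomp hsub ε hε
  have hloc : ∀ a₀ : closure U', ∃ δ > 0, ∀ a ∈ Metric.ball a₀.1 δ, ∀ b ∈ Metric.ball a₀.1 δ,
      a ∈ U → b ∈ U → |φ b - φ a| ≤ ε * √(eDist a b) := by
    rintro ⟨a₀, ha₀⟩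
    obtain ⟨grad, hgrad⟩ := hUID a₀ (hsub ha₀)
    obtain ⟨δ, hδ, H⟩ := Metric.eventually_nhds_iff.1
      (hgrad.eventually_abs_sub_le hskew (hφ a₀ (hsub ha₀)) hε)
    exact ⟨δ, hδ, fun a ha b hb haU hbU => H (y := (a, b)) (max_lt ha hb) haU hbU⟩
  choose δ hδ H using hloc
  obtain ⟨r, hr, hball⟩ := lebesgue_number_lemma_of_metric hcomp
    (c := fun a₀ => Metric.ball a₀.1 (δ a₀)) (fun _ => Metric.isOpen_ball)
    fun x hx => Set.mem_iUnion.2 ⟨⟨x, hx⟩, Metric.mem_ball_self (hδ _)⟩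
  refine ⟨r, hr, fun a ha b hb _ hab => ?_⟩
  obtain ⟨a₀, h₀⟩ := hball a (subset_closure ha)
  exact H a₀ a (h₀ (Metric.mem_ball_self hr)) b
    (h₀ (Metric.mem_ball'.2 ((dist_le_eDist a b).trans_lt hab)))
    (hsub (subset_closure ha)) (hsub (subset_closure hb))

end Step2
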